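/- arXiv:1810.12591 — 2 statements merged into one kernel-verified Lean document; each statement's English description precedes it below -/
import Mathlib

section
/- Let f, g : X → Y be continuous maps with path-connected codomain Y. Then D(f,g) + 1 ≤ (cat(f) + 1)(cat(g) + 1). -/
open ContinuousMap

/-- The homotopic distance between two continuous maps `f g : C(X, Y)`:
the least `n : ℕ∞` such that `X` admits an open cover by `n + 1` sets on each of
which the restrictions of `f` and `g` are homotopic; `⊤` if no such cover exists. -/
noncomputable def homotopicDistance {X Y : Type*} [TopologicalSpace X] [TopologicalSpace Y]
    (f g : C(X, Y)) : ℕ∞ :=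
  sInf ((Nat.cast : ℕ → ℕ∞) '' {n : ℕ | ∃ U : Fin (n + 1) → Set X,
    (∀ j, IsOpen (U j)) ∧ (⋃ j, U j) = Set.univ ∧
    ∀ j, (f.restrict (U j)).Homotopic (g.restrict (U j))})

/-- The (normalized) Lusternik–Schnirelmann category of a space `X`: the least
`n : ℕ∞` such that `X` admits an open cover by `n + 1` sets on each of which the
inclusion into `X` is null-homotopic. -/
noncomputable def lsCat (X : Type*) [TopologicalSpace X] : ℕ∞ :=
  sInf ((Nat.cast : ℕ → ℕ∞) '' {n : ℕ | ∃ U : Fin (n + 1) → Set X,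
    (∀ j, IsOpen (U j)) ∧ (⋃ j, U j) = Set.univ ∧
    ∀ j, ∃ y : X, ((ContinuousMap.id X).restrict (U j)).Homotopic
      (ContinuousMap.const (U j) y)})

theorem homotopicDistance_le_of_cover {X Y ι : Type*} [TopologicalSpace X] [TopologicalSpace Y]
    [Fintype ι] {f g : C(X, Y)} {n : ℕ} (hn : Fintype.card ι = n + 1) (U : ι → Set X)
    (hU : ∀ j, IsOpen (U j)) (hcover : (⋃ j, U j) = Set.univ)
    (hfg : ∀ j, (f.restrict (U j)).Homotopic (g.restrict (U j))) :
    homotopicDistance f g ≤ n := by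
  refine sInf_le ⟨n, ⟨fun j => U ((Fintype.equivFinOfCardEq hn).symm j), fun j => hU _, ?_,
    fun j => hfg _⟩, rfl⟩
  rw [← hcover]
  exact (Fintype.equivFinOfCardEq hn).symm.surjective.iUnion_comp U

theorem exists_cover_of_homotopicDistance_ne_top {X Y : Type*} [TopologicalSpace X]
    [TopologicalSpace Y] {f g : C(X, Y)} (h : homotopicDistance f g ≠ ⊤) :
    ∃ n : ℕ, homotopicDistance f g = n ∧ ∃ U : Fin (n + 1) → Set X,
      (∀ j, IsOpen (U j)) ∧ (⋃ j, U j) = Set.univ ∧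
        ∀ j, (f.restrict (U j)).Homotopic (g.restrict (U j)) := by
  have hne : ((Nat.cast : ℕ → ℕ∞) '' {n : ℕ | ∃ U : Fin (n + 1) → Set X,
      (∀ j, IsOpen (U j)) ∧ (⋃ j, U j) = Set.univ ∧
        ∀ j, (f.restrict (U j)).Homotopic (g.restrict (U j))}).Nonempty := by
    by_contra hempty
    rw [Set.not_nonempty_iff_eq_empty] at hempty
    exact h (by rw [homotopicDistance, hempty, sInf_empty])
  obtain ⟨n, hn, hnD⟩ := csInf_mem hne
  exact ⟨n, hnD.symm, hn⟩

theorem ContinuousMap.Homotopic.restrict_mono {X Y : Type*} [TopologicalSpace X]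
    [TopologicalSpace Y] {f g : C(X, Y)} {s t : Set X} (hst : s ⊆ t)
    (h : (f.restrict t).Homotopic (g.restrict t)) :
    (f.restrict s).Homotopic (g.restrict s) :=
  h.comp (.refl ⟨Set.inclusion hst, continuous_inclusion hst⟩)

/-- `D(f,g) + 1 ≤ (cat f + 1)(cat g + 1)`, where `cat f = D(f, c)` for a
constant map `c` (`Y` path-connected). -/
theorem homotopicDistance_le_cat_mul {X Y : Type*} [TopologicalSpace X] [TopologicalSpace Y]
    [PathConnectedSpace Y] (f g : C(X, Y)) (y₀ : Y) :
    homotopicDistance f g + 1 ≤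
      (homotopicDistance f (ContinuousMap.const X y₀) + 1) *
        (homotopicDistance g (ContinuousMap.const X y₀) + 1) := by
  by_cases hf : homotopicDistance f (ContinuousMap.const X y₀) = ⊤
  · simp [hf]
  by_cases hg : homotopicDistance g (ContinuousMap.const X y₀) = ⊤
  · simp [hg]
  obtain ⟨m, hm, U, hUo, hU, hfU⟩ := exists_cover_of_homotopicDistance_ne_top hf
  obtain ⟨n, hn, V, hVo, hV, hgV⟩ := exists_cover_of_homotopicDistance_ne_top hg
  have hcard : Fintype.card (Fin (m + 1) × Fin (n + 1)) = (m * n + m + n) + 1 := by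
    simp only [Fintype.card_prod, Fintype.card_fin]
    ring
  have hD : homotopicDistance f g ≤ (m * n + m + n : ℕ) := by
    refine homotopicDistance_le_of_cover hcard (fun p => U p.1 ∩ V p.2)
      (fun p => (hUo p.1).inter (hVo p.2)) ?_ fun p =>
        ((hfU p.1).restrict_mono Set.inter_subset_left).trans
          ((hgV p.2).restrict_mono Set.inter_subset_right).symm
    refine Set.eq_univ_of_forall fun x => ?_
    obtain ⟨i, hi⟩ := Set.mem_iUnion.1 (hU ▸ Set.mem_univ x)
    obtain ⟨j, hj⟩ := Set.mem_iUnion.1 (hV ▸ Set.mem_univ x)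
    exact Set.mem_iUnion.2 ⟨(i, j), hi, hj⟩
  rw [hm, hn]
  calc homotopicDistance f g + 1 ≤ ((m * n + m + n : ℕ) : ℕ∞) + 1 := by gcongr
    _ = (m + 1) * (n + 1) := by push_cast; ring
end

section
/- Let f, g : X → Y be continuous maps and let β : X' → X be a continuous map admitting a right homotopy inverse (i.e., there is a continuous γ : X → X' with β ∘ γ homotopic to id_X). Then D(f ∘ β, g ∘ β) = D(f, g). -/
open ContinuousMap

/-- If every set on which one pair of maps has homotopic restrictions pulls back along `h` to such a
set for a second pair, then the homotopic distance of the second pair is at most that of the first. -/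
theorem homotopicDistance_le_of_preimage {X X' Y Y' : Type*} [TopologicalSpace X]
    [TopologicalSpace X'] [TopologicalSpace Y] [TopologicalSpace Y']
    {f g : C(X, Y)} {f' g' : C(X', Y')} (h : C(X', X))
    (H : ∀ U : Set X, (f.restrict U).Homotopic (g.restrict U) →
      (f'.restrict (h ⁻¹' U)).Homotopic (g'.restrict (h ⁻¹' U))) :
    homotopicDistance f' g' ≤ homotopicDistance f g := by
  refine sInf_le_sInf (Set.image_mono ?_)
  rintro n ⟨U, hU, hcover, hhom⟩
  refine ⟨fun j => h ⁻¹' U j, fun j => (hU j).preimage h.continuous, ?_, fun j => H _ (hhom j)⟩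
  rw [← Set.preimage_iUnion, hcover, Set.preimage_univ]

/-- Precomposition does not increase the homotopic distance. -/
theorem homotopicDistance_comp_le {X X' Y : Type*} [TopologicalSpace X]
    [TopologicalSpace X'] [TopologicalSpace Y] (f g : C(X, Y)) (h : C(X', X)) :
    homotopicDistance (f.comp h) (g.comp h) ≤ homotopicDistance f g :=
  homotopicDistance_le_of_preimage h fun U hU =>
    hU.comp (ContinuousMap.Homotopic.refl (h.restrictPreimage U))

/-- Homotopic distance does not increase when the maps are replaced by homotopic ones. -/
theorem homotopicDistance_le_of_homotopic {X Y : Type*} [TopologicalSpace X]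
    [TopologicalSpace Y] {f f' g g' : C(X, Y)} (hf : f.Homotopic f') (hg : g.Homotopic g') :
    homotopicDistance f' g' ≤ homotopicDistance f g := by
  refine homotopicDistance_le_of_preimage (ContinuousMap.id X) fun U hU => ?_
  let i : C(U, X) := ⟨Subtype.val, continuous_subtype_val⟩
  exact ((hf.symm.comp (.refl i)).trans hU).trans (hg.comp (.refl i))

/-- precomposing with a map having a right homotopy inverse preserves the
homotopic distance. -/
theorem homotopicDistance_comp_right_homotopy_inverse {X X' Y : Type*} [TopologicalSpace X]
    [TopologicalSpace X'] [TopologicalSpace Y] (f g : C(X, Y)) (β : C(X', X))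
    (hβ : ∃ γ : C(X, X'), (β.comp γ).Homotopic (ContinuousMap.id X)) :
    homotopicDistance (f.comp β) (g.comp β) = homotopicDistance f g := by
  obtain ⟨γ, hγ⟩ := hβ
  refine le_antisymm (homotopicDistance_comp_le f g β) ?_
  calc homotopicDistance f g
      ≤ homotopicDistance (f.comp (β.comp γ)) (g.comp (β.comp γ)) :=
        homotopicDistance_le_of_homotopic
          ((ContinuousMap.Homotopic.refl f).comp hγ) ((ContinuousMap.Homotopic.refl g).comp hγ)
    _ ≤ homotopicDistance (f.comp β) (g.comp β) :=
        homotopicDistance_comp_le (f.comp β) (g.comp β) γ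
end
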